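/- Let S from H₀ to H₁ and T from H₁ to H₂ be closed densely defined operators between complex Hilbert spaces with range S ⊆ ker T (a Hilbert complex). Then ker S† decomposes as the orthogonal direct sum ker S† = (ker T ∩ ker S†) ⊕ closure(range T†). -/

import Mathlib

/-!
STATEMENT 8: Let S : H₀ → H₁ and T : H₁ → H₂ be closed densely defined operators between
complex Hilbert spaces with range S ⊆ ker T (a Hilbert complex). Then ker S† decomposes as
the orthogonal direct sum ker S† = (ker T ∩ ker S†) ⊕ closure(range T†).
-/

noncomputable section

/-- The kernel of a partially defined operator, as a submodule of the ambient space. -/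
def pKer {R E F : Type*} [Ring R] [AddCommGroup E] [Module R E] [AddCommGroup F] [Module R F]
    (P : E →ₗ.[R] F) : Submodule R E :=
  (LinearMap.ker P.toFun).map P.domain.subtype

/-- The range of a partially defined operator. -/
def pRan {R E F : Type*} [Ring R] [AddCommGroup E] [Module R E] [AddCommGroup F] [Module R F]
    (P : E →ₗ.[R] F) : Submodule R F :=
  LinearMap.range P.toFun

/-- A closed linear relation between Hilbert spaces equals its double adjoint. -/
theorem Submodule.adjoint_adjoint_of_isClosed {𝕜 E F : Type*} [RCLike 𝕜]
    [NormedAddCommGroup E] [InnerProductSpace 𝕜 E] [CompleteSpace E]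
    [NormedAddCommGroup F] [InnerProductSpace 𝕜 F] [CompleteSpace F]
    (g : Submodule 𝕜 (E × F)) (hg : IsClosed (g : Set (E × F))) :
    g.adjoint.adjoint = g := by
  ext x
  constructor
  · intro hx
    let g' : Submodule 𝕜 (WithLp 2 (E × F)) :=
      g.comap (WithLp.linearEquiv 2 𝕜 (E × F)).toLinearMap
    have hg' : IsClosed (g' : Set (WithLp 2 (E × F))) :=
      hg.preimage (WithLp.prod_continuous_ofLp 2 E F)
    have key : WithLp.toLp 2 x ∈ g'ᗮᗮ := by
      rw [Submodule.mem_orthogonal]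
      intro u hu
      have hu' : (u.snd, -u.fst) ∈ g.adjoint := by
        rw [Submodule.mem_adjoint_iff]
        intro a b hab
        have h := (Submodule.mem_orthogonal _ _).1 hu (WithLp.toLp 2 (a, b)) hab
        simpa [WithLp.prod_inner_apply, add_comm] using h
      have h := (Submodule.mem_adjoint_iff _ _).1 hx _ _ hu'
      rw [inner_neg_left, ← neg_add', neg_eq_zero] at h
      simpa [WithLp.prod_inner_apply] using h
    rw [Submodule.orthogonal_orthogonal_eq_closure,
      hg'.submodule_topologicalClosure_eq] at key
    exact key
  · intro hx
    rw [Submodule.mem_adjoint_iff]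
    intro b a hba
    have h := (Submodule.mem_adjoint_iff _ _).1 hba x.1 x.2 hx
    have h' := congrArg (starRingEnd 𝕜) h
    rw [map_sub, inner_conj_symm, inner_conj_symm, map_zero] at h'
    rw [← neg_sub, h', neg_zero]

theorem mem_pKer_iff {R E F : Type*} [Ring R] [AddCommGroup E] [Module R E] [AddCommGroup F]
    [Module R F] (P : E →ₗ.[R] F) (x : E) : x ∈ pKer P ↔ (x, 0) ∈ P.graph := by
  simp only [pKer, Submodule.mem_map, LinearMap.mem_ker, LinearPMap.mem_graph_iff]
  exact exists_congr fun y => and_comm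

theorem mem_pRan_iff {R E F : Type*} [Ring R] [AddCommGroup E] [Module R E] [AddCommGroup F]
    [Module R F] (P : E →ₗ.[R] F) (y : F) : y ∈ pRan P ↔ ∃ x, (x, y) ∈ P.graph := by
  simp [pRan, LinearPMap.mem_graph_iff]

section Adjoint

variable {𝕜 E F : Type*} [RCLike 𝕜]
  [NormedAddCommGroup E] [InnerProductSpace 𝕜 E] [CompleteSpace E]
  [NormedAddCommGroup F] [InnerProductSpace 𝕜 F]

theorem pKer_adjoint (P : E →ₗ.[𝕜] F) (hP : Dense (P.domain : Set E)) :
    pKer P.adjoint = (pRan P)ᗮ := by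
  ext y
  rw [mem_pKer_iff, LinearPMap.adjoint_graph_eq_graph_adjoint hP, Submodule.mem_adjoint_iff,
    Submodule.mem_orthogonal]
  simp only [inner_zero_right, sub_zero, mem_pRan_iff, forall_exists_index]
  exact forall_comm

theorem orthogonal_pRan_adjoint [CompleteSpace F] (P : E →ₗ.[𝕜] F)
    (hP : Dense (P.domain : Set E)) (hPc : P.IsClosed) :
    (pRan P.adjoint)ᗮ = pKer P := by
  ext x
  rw [mem_pKer_iff, ← Submodule.adjoint_adjoint_of_isClosed P.graph hPc,
    ← LinearPMap.adjoint_graph_eq_graph_adjoint hP, Submodule.mem_adjoint_iff,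
    Submodule.mem_orthogonal]
  simp only [inner_zero_right, sub_zero, mem_pRan_iff, forall_exists_index]
  exact forall_comm

end Adjoint

theorem hilbert_complex_cokernel_decomposition
    {H₀ H₁ H₂ : Type*}
    [NormedAddCommGroup H₀] [InnerProductSpace ℂ H₀] [CompleteSpace H₀]
    [NormedAddCommGroup H₁] [InnerProductSpace ℂ H₁] [CompleteSpace H₁]
    [NormedAddCommGroup H₂] [InnerProductSpace ℂ H₂] [CompleteSpace H₂]
    (S : H₀ →ₗ.[ℂ] H₁) (T : H₁ →ₗ.[ℂ] H₂)
    (hSd : Dense (S.domain : Set H₀)) (hSc : S.IsClosed)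
    (hTd : Dense (T.domain : Set H₁)) (hTc : T.IsClosed)
    (hST : pRan S ≤ pKer T) :
    (∀ x ∈ pKer T ⊓ pKer S.adjoint, ∀ y ∈ (pRan T.adjoint).topologicalClosure,
      @inner ℂ H₁ _ x y = 0) ∧
    (pKer T ⊓ pKer S.adjoint) ⊔ (pRan T.adjoint).topologicalClosure = pKer S.adjoint := by
  have hker : (pRan T.adjoint).topologicalClosureᗮ = pKer T := by
    rw [Submodule.orthogonal_closure, orthogonal_pRan_adjoint T hTd hTc]
  refine ⟨fun x hx y hy => ?_, ?_⟩
  · exact Submodule.inner_left_of_mem_orthogonal hy (hker.symm ▸ hx.1)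
  · have hle : (pRan T.adjoint).topologicalClosure ≤ pKer S.adjoint := by
      rw [pKer_adjoint S hSd]
      exact (Submodule.le_orthogonal_orthogonal _).trans
        (Submodule.orthogonal_le (hST.trans_eq hker.symm))
    have : CompleteSpace (pRan T.adjoint).topologicalClosure :=
      (pRan T.adjoint).isClosed_topologicalClosure.completeSpace_coe
    rw [← hker, sup_comm]
    exact Submodule.sup_orthogonal_inf_of_hasOrthogonalProjection hle
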